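/- Let n, m ≥ 1. If there exists a closed immersion of schemes over Spec ℂ from the fiber product ℙⁿ_ℂ ×_{Spec ℂ} ℙ¹_ℂ into projective m-space ℙᵐ_ℂ, then m ≥ 2n + 1. -/

import Mathlib

open AlgebraicGeometry CategoryTheory CategoryTheory.Limits

attribute [local instance] MvPolynomial.gradedAlgebra

noncomputable section

/-- Projective `k`-space over `ℂ`, as the `Proj` of the standard graded polynomial ring in
`k + 1` variables. -/
def ProjSpace (k : ℕ) : Scheme :=
  Proj (MvPolynomial.homogeneousSubmodule (Fin (k + 1)) ℂ)

open scoped TensorProduct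

/-- Along a strictly descending chain of primes the height grows at least by the length. -/
theorem Ideal.height_add_le_of_chain {R : Type*} [CommRing R] (c : ℕ → Ideal R)
    (hc : ∀ i, (c i).IsPrime) (k : ℕ) (hlt : ∀ i < k, c (i + 1) < c i) :
    (c k).height + k ≤ (c 0).height := by
  induction k with
  | zero => simp
  | succ k ih =>
    have := hc k
    have := hc (k + 1)
    have h := Ideal.height_add_one_le_of_lt_of_isPrime (hlt k k.lt_succ_self)
    have h' := ih fun i hi ↦ hlt i (hi.trans k.lt_succ_self)
    calc (c (k + 1)).height + ((k + 1 : ℕ) : ℕ∞) = (c (k + 1)).height + 1 + k := by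
          push_cast; ring
      _ ≤ (c k).height + k := by gcongr
      _ ≤ _ := h'

/-- For augmented finite type algebras `A` and `B`, heights at the augmentation ideals add up
in `A ⊗[k] B`. -/
theorem Ideal.height_ker_add_le_height_ker_lift {k A B : Type*} [Field k] [CommRing A]
    [CommRing B] [IsDomain B] [Algebra k A] [Algebra k B] [Algebra.FiniteType k A]
    [Algebra.FiniteType k B] (εA : A →ₐ[k] k) (εB : B →ₐ[k] k) (c : ℕ → Ideal B)
    (hc : ∀ i, (c i).IsPrime) (hc0 : c 0 = RingHom.ker εB) (n : ℕ)
    (hlt : ∀ i < n, c (i + 1) < c i) :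
    (RingHom.ker εA).height + n ≤
      (RingHom.ker (Algebra.TensorProduct.lift εA εB fun _ _ ↦ .all _ _)).height := by
  let f : A ⊗[k] B →ₐ[k] B :=
    Algebra.TensorProduct.lift ((Algebra.ofId k B).comp εA) (AlgHom.id k B) fun _ _ ↦ .all _ _
  have hf : Function.Surjective f := fun y ↦ ⟨1 ⊗ₜ y, by simp [f]⟩
  have hεf : εB.comp f = Algebra.TensorProduct.lift εA εB fun _ _ ↦ .all _ _ := by
    ext <;> simp [f]
  have : IsNoetherianRing A := Algebra.FiniteType.isNoetherianRing k A
  have : IsNoetherianRing (A ⊗[k] B) := Algebra.FiniteType.isNoetherianRing A _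
  have hkf : (RingHom.ker f).IsPrime := RingHom.ker_isPrime f
  have hkεA : (RingHom.ker εA).IsPrime := RingHom.ker_isPrime εA
  have hlo : (RingHom.ker f).LiesOver (RingHom.ker εA) := by
    constructor
    ext x
    simp [f, Ideal.mem_comap, Algebra.ofId_apply]
  have htf : (RingHom.ker εA).height ≤ (RingHom.ker f).height := by
    rw [Ideal.height_eq_height_add_of_liesOver_of_hasGoingDown (RingHom.ker εA) (RingHom.ker f)]
    exact le_self_add
  have hle := Ideal.height_add_le_of_chain (fun i ↦ (c i).comap f)
    (fun i ↦ have := hc i; inferInstance) n fun i hi ↦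
      lt_of_le_of_ne (Ideal.comap_mono (hlt i hi).le)
        fun h ↦ (hlt i hi).ne (Ideal.comap_injective_of_surjective _ hf h)
  have e : (c 0).comap f = RingHom.ker (Algebra.TensorProduct.lift εA εB fun _ _ ↦ .all _ _) := by
    rw [hc0, ← hεf]; rfl
  rw [← e]
  refine le_trans ?_ hle
  gcongr
  refine htf.trans (Ideal.height_mono fun x hx ↦ ?_)
  rw [Ideal.mem_comap, RingHom.mem_ker.1 hx]
  exact zero_mem _

/-- If the ideals of `A` and `B` in the polynomial ring together cut out only the origin, then
the augmentation ideal of `A ⊗[k] B` is minimal over the ideal of the diagonal, so its height is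
at most the number of variables. -/
theorem MvPolynomial.height_ker_lift_le_card {k σ A B : Type*} [Field k] [Fintype σ] [CommRing A]
    [CommRing B] [Algebra k A] [Algebra k B] (πA : MvPolynomial σ k →ₐ[k] A)
    (πB : MvPolynomial σ k →ₐ[k] B) (hπA : Function.Surjective πA) (hπB : Function.Surjective πB)
    (εA : A →ₐ[k] k) (εB : B →ₐ[k] k) (hεA : ∀ i, εA (πA (X i)) = 0) (hεB : ∀ i, εB (πB (X i)) = 0)
    (H : ∀ J : Ideal (MvPolynomial σ k), J.IsPrime → RingHom.ker πA ≤ J → RingHom.ker πB ≤ J →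
      ∀ i, X i ∈ J) :
    (RingHom.ker (Algebra.TensorProduct.lift εA εB fun _ _ ↦ .all _ _)).height ≤
      Fintype.card σ := by
  have : Algebra.FiniteType k A := .of_surjective πA hπA
  have : Algebra.FiniteType k B := .of_surjective πB hπB
  have : IsNoetherianRing A := Algebra.FiniteType.isNoetherianRing k A
  have : IsNoetherianRing (A ⊗[k] B) := Algebra.FiniteType.isNoetherianRing A _
  let d : σ → A ⊗[k] B := fun i ↦ πA (X i) ⊗ₜ[k] (1 : B) - (1 : A) ⊗ₜ[k] πB (X i)
  have hcard : (Set.range d).ncard ≤ Fintype.card σ := by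
    rw [← Set.image_univ, ← Nat.card_eq_fintype_card, ← Set.ncard_univ]
    exact Set.ncard_image_le
  refine le_trans (Ideal.height_le_card_of_mem_minimalPrimes_span (Set.finite_range d) ?_)
    (by exact_mod_cast hcard)
  refine ⟨⟨RingHom.ker_isPrime _, ?_⟩, ?_⟩
  · rw [Ideal.span_le]
    rintro _ ⟨i, rfl⟩
    simp [d, hεA, hεB]
  · rintro N ⟨hN, hdN⟩ -
    let μ : A ⊗[k] B →ₐ[k] (A ⊗[k] B) ⧸ N := Ideal.Quotient.mkₐ k N
    let gA := (μ.comp Algebra.TensorProduct.includeLeft).comp πA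
    let gB := (μ.comp Algebra.TensorProduct.includeRight).comp πB
    have hg : gA = gB := by
      ext i
      exact (Ideal.Quotient.mk_eq_mk_iff_sub_mem _ _).2 (hdN (Ideal.subset_span ⟨i, rfl⟩))
    have hX : ∀ i, gA (X i) = 0 := H (RingHom.ker gA) (RingHom.ker_isPrime gA)
      (fun x hx ↦ by
        rw [RingHom.mem_ker, AlgHom.comp_apply, RingHom.mem_ker.1 hx, map_zero])
      (fun x hx ↦ by
        rw [RingHom.mem_ker, hg, AlgHom.comp_apply, RingHom.mem_ker.1 hx, map_zero])
    have hμ : μ = (Algebra.ofId k _).comp (Algebra.TensorProduct.lift εA εB fun _ _ ↦ .all _ _) := by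
      refine Algebra.TensorProduct.ext ?_ ?_
      · rw [← AlgHom.cancel_right hπA]
        ext i
        exact (hX i).trans (by simp [hεA])
      · apply (AlgHom.cancel_right hπB).1
        ext i
        exact ((DFunLike.congr_fun hg (X i)).symm.trans (hX i)).trans (by simp [hεB])
    intro x hx
    have : μ x = 0 := by
      rw [hμ, AlgHom.comp_apply, RingHom.mem_ker.1 hx, map_zero]
    exact Ideal.Quotient.eq_zero_iff_mem.1 this

/-- Algebraic form of the projective dimension theorem: if two chains of primes descending from
the ideal of the origin end in primes `P` and `Q` such that `P + Q` is supported at the origin,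
then the sum of their lengths is at most the number of variables. -/
theorem MvPolynomial.add_le_card_of_chains {k σ : Type*} [Field k] [Fintype σ]
    (p q : ℕ → Ideal (MvPolynomial σ k)) (hp : ∀ i, (p i).IsPrime) (hq : ∀ i, (q i).IsPrime)
    (hp0 : p 0 = RingHom.ker (aeval (R := k) (0 : σ → k)))
    (hq0 : q 0 = RingHom.ker (aeval (R := k) (0 : σ → k)))
    (hpa : Antitone p) (hqa : Antitone q)
    (a b : ℕ) (hpl : ∀ i < a, p (i + 1) < p i) (hql : ∀ i < b, q (i + 1) < q i)
    (H : ∀ J : Ideal (MvPolynomial σ k), J.IsPrime → p a ≤ J → q b ≤ J → ∀ i, X i ∈ J) :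
    a + b ≤ Fintype.card σ := by
  have key (p : ℕ → Ideal (MvPolynomial σ k)) (hp : ∀ i, (p i).IsPrime) (hpa : Antitone p) (a : ℕ)
      (hp0 : p 0 = RingHom.ker (aeval (R := k) (0 : σ → k)))
      (hpl : ∀ i < a, p (i + 1) < p i) :
      ∃ (ε : (MvPolynomial σ k ⧸ p a) →ₐ[k] k) (c : ℕ → Ideal (MvPolynomial σ k ⧸ p a)),
        (∀ i, ε (Ideal.Quotient.mkₐ k (p a) (X i)) = 0) ∧ (∀ i, (c i).IsPrime) ∧
        c 0 = RingHom.ker ε ∧ ∀ i < a, c (i + 1) < c i := by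
    let π := Ideal.Quotient.mkₐ k (p a)
    have hπ : Function.Surjective π := Ideal.Quotient.mkₐ_surjective k _
    have hk : RingHom.ker π = p a := Ideal.Quotient.mkₐ_ker k _
    have hcomap (i : ℕ) (hi : i ≤ a) : ((p i).map π).comap π = p i := by
      rw [Ideal.comap_map_of_surjective' _ hπ, hk, sup_eq_left]
      exact hpa hi
    have hle : ∀ f ∈ p a, aeval (R := k) (0 : σ → k) f = 0 := fun f hf ↦
      RingHom.mem_ker.1 (hp0 ▸ hpa a.zero_le hf)
    refine ⟨Ideal.Quotient.liftₐ (p a) (aeval (R := k) (0 : σ → k)) hle,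
      fun i ↦ (p (min i a)).map π, fun i ↦ ?_, fun i ↦ ?_, ?_, fun i hi ↦ ?_⟩
    · exact (Ideal.Quotient.lift_mk (p a) _ hle).trans (by simp)
    · have := hp (min i a)
      exact Ideal.map_isPrime_of_surjective hπ (hk.trans_le (hpa (min_le_right _ _)))
    · apply Ideal.comap_injective_of_surjective _ hπ
      simp only [Nat.zero_min]
      exact (hcomap 0 a.zero_le).trans hp0
    · simp only [min_eq_left hi.le, min_eq_left (Nat.succ_le_of_lt hi)]
      refine lt_of_le_of_ne (Ideal.map_mono (hpa i.le_succ)) fun h ↦ (hpl i hi).ne ?_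
      rw [← hcomap i hi.le, ← h, hcomap (i + 1) hi]
  obtain ⟨εA, c, hεA, hc, hc0, hcl⟩ := key p hp hpa a hp0 hpl
  obtain ⟨εB, d, hεB, hd, hd0, hdl⟩ := key q hq hqa b hq0 hql
  have := hq b
  have h₁ := Ideal.height_add_le_of_chain c hc a hcl
  have h₂ := Ideal.height_ker_add_le_height_ker_lift εA εB d hd hd0 b hdl
  have h₃ := height_ker_lift_le_card _ _ (Ideal.Quotient.mkₐ_surjective k _)
    (Ideal.Quotient.mkₐ_surjective k _) εA εB hεA hεB
    fun J hJ h₁ h₂ ↦ H J hJ ((Ideal.Quotient.mkₐ_ker k (p a)).ge.trans h₁)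
      ((Ideal.Quotient.mkₐ_ker k (q b)).ge.trans h₂)
  rw [hc0] at h₁
  have h₄ : (a : ℕ∞) + b ≤ (RingHom.ker εA).height + b := by
    gcongr
    exact le_add_self.trans h₁
  exact_mod_cast (h₄.trans h₂).trans h₃

section ProjectiveSpectrum

open MvPolynomial HomogeneousIdeal

variable {k σ : Type*} [Field k]

theorem MvPolynomial.decompose_homogeneousSubmodule_zero (f : MvPolynomial σ k) :
    (DirectSum.decompose (homogeneousSubmodule σ k) f 0 : MvPolynomial σ k) =
      C (constantCoeff f) := by
  rw [constantCoeff_eq, ← homogeneousComponent_zero]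
  exact decomposition.decompose'_apply f 0

theorem MvPolynomial.X_mem_span_X_image {s : Set σ} {i : σ} :
    (X i : MvPolynomial σ k) ∈ Ideal.span (X '' s) ↔ i ∈ s := by
  classical
  simp [mem_ideal_span_X_image, support_X, Finsupp.single_apply]

theorem MvPolynomial.isPrime_span_X_image (s : Set σ) :
    (Ideal.span (X '' s : Set (MvPolynomial σ k))).IsPrime := by
  classical
  let φ : MvPolynomial σ k →ₐ[k] MvPolynomial σ k := aeval fun i ↦ if i ∈ s then 0 else X i
  have hφ : Ideal.span (X '' s) = RingHom.ker φ := by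
    refine le_antisymm (Ideal.span_le.2 ?_) fun f hf ↦ ?_
    · rintro _ ⟨i, hi, rfl⟩
      simp [φ, hi]
    · let π := Ideal.Quotient.mkₐ k (Ideal.span (X '' s : Set (MvPolynomial σ k)))
      have hπ : π = π.comp φ := by
        ext i
        by_cases hi : i ∈ s
        · simpa [π, φ, hi] using Ideal.Quotient.eq_zero_iff_mem.2 (X_mem_span_X_image.2 hi)
        · simp [φ, hi]
      have : π f = 0 := by
        rw [hπ, AlgHom.comp_apply, RingHom.mem_ker.1 hf, map_zero]
      exact Ideal.Quotient.eq_zero_iff_mem.1 this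
  rw [hφ]
  exact RingHom.ker_isPrime φ

theorem ProjectiveSpectrum.asHomogeneousIdeal_lt_ker_aeval_zero
    (x : ProjectiveSpectrum (homogeneousSubmodule σ k)) :
    x.asHomogeneousIdeal.toIdeal < RingHom.ker (aeval (R := k) (0 : σ → k)) := by
  refine lt_of_le_of_ne (fun f hf ↦ ?_) fun h ↦ x.not_irrelevant_le fun f hf ↦ ?_
  · have h0 := x.asHomogeneousIdeal.isHomogeneous 0 hf
    rw [decompose_homogeneousSubmodule_zero] at h0
    rw [RingHom.mem_ker, aeval_zero]
    by_contra hne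
    exact x.isPrime.ne_top (Ideal.eq_top_of_isUnit_mem _ h0 ((Ne.isUnit hne).map C))
  · have h0 : (DirectSum.decompose (homogeneousSubmodule σ k) f 0 : MvPolynomial σ k) = 0 := hf
    rw [decompose_homogeneousSubmodule_zero, C_eq_zero] at h0
    change f ∈ x.asHomogeneousIdeal.toIdeal
    rw [h, RingHom.mem_ker, aeval_zero, h0, map_zero]

/-- Two chains in projective space whose most generic points have no common specialization have
total length less than the dimension. -/
theorem ProjectiveSpectrum.add_lt_of_chains {N : ℕ} (x y :
    ℕ → ProjectiveSpectrum (homogeneousSubmodule (Fin (N + 1)) k)) (hx : Antitone x)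
    (hy : Antitone y) (a b : ℕ) (hxa : ∀ i < a, x (i + 1) ≠ x i) (hyb : ∀ i < b, y (i + 1) ≠ y i)
    (H : ∀ z, x a ≤ z → y b ≤ z → False) : a + b < N := by
  let c (x : ℕ → ProjectiveSpectrum (homogeneousSubmodule (Fin (N + 1)) k)) :
      ℕ → Ideal (MvPolynomial (Fin (N + 1)) k) := fun i ↦
    i.casesOn (RingHom.ker (aeval (R := k) (0 : Fin (N + 1) → k)))
      fun i ↦ (x i).asHomogeneousIdeal.toIdeal
  have hc (x) (i) : (c x i).IsPrime := by
    cases i with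
    | zero => exact RingHom.ker_isPrime _
    | succ i => exact (x i).isPrime
  have hca (x) (hx : Antitone x) : Antitone (c x) := by
    refine antitone_nat_of_succ_le fun i ↦ ?_
    cases i with
    | zero => exact (x 0).asHomogeneousIdeal_lt_ker_aeval_zero.le
    | succ i => exact hx i.le_succ
  have hcl (x) (a) (hx : Antitone x) (hxa : ∀ i < a, x (i + 1) ≠ x i) (i) (hi : i < a + 1) :
      c x (i + 1) < c x i := by
    cases i with
    | zero => exact (x 0).asHomogeneousIdeal_lt_ker_aeval_zero
    | succ i => exact (lt_of_le_of_ne (hx i.le_succ) (hxa i (by omega)) : x (i + 1) < x i)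
  have := MvPolynomial.add_le_card_of_chains (c x) (c y) (hc x) (hc y) rfl rfl (hca x hx)
    (hca y hy) (a + 1) (b + 1) (hcl x a hx hxa) (hcl y b hy hyb) fun J hJ h₁ h₂ i ↦ by
      by_cases hirr : irrelevant (homogeneousSubmodule (Fin (N + 1)) k) ≤
          J.homogeneousCore (homogeneousSubmodule (Fin (N + 1)) k)
      · exact Ideal.toIdeal_homogeneousCore_le _ J
          (hirr (mem_irrelevant_of_mem _ one_pos (isHomogeneous_X k i)))
      · have hle (x : ProjectiveSpectrum (homogeneousSubmodule (Fin (N + 1)) k))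
            (h : x.asHomogeneousIdeal.toIdeal ≤ J) : x.asHomogeneousIdeal ≤
            J.homogeneousCore (homogeneousSubmodule (Fin (N + 1)) k) := by
          have := Ideal.homogeneousCore_mono (homogeneousSubmodule (Fin (N + 1)) k) h
          rwa [HomogeneousIdeal.toIdeal_homogeneousCore_eq_self] at this
        exact (H ⟨_, hJ.homogeneousCore, hirr⟩ (hle _ h₁) (hle _ h₂)).elim
  simp only [Fintype.card_fin] at this
  omega

/-- The point of projective space where exactly the variables in a proper subset vanish, i.e. the
generic point of a coordinate linear subspace. -/
def ProjectiveSpectrum.coordinate (s : Set σ) (hs : s ≠ Set.univ) :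
    ProjectiveSpectrum (homogeneousSubmodule σ k) where
  asHomogeneousIdeal := ⟨Ideal.span (X '' s), Ideal.homogeneous_span _ _ (by
    rintro _ ⟨i, -, rfl⟩
    exact ⟨1, isHomogeneous_X k i⟩)⟩
  isPrime := isPrime_span_X_image s
  not_irrelevant_le h := by
    obtain ⟨i, hi⟩ := (Set.ne_univ_iff_exists_notMem s).1 hs
    exact hi (X_mem_span_X_image.1 (h (mem_irrelevant_of_mem _ one_pos (isHomogeneous_X k i))))

end ProjectiveSpectrum

section Chains

/-- A descending sequence of specializations lifts along a surjective generalizing map. -/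
theorem GeneralizingMap.exists_lift_chain {X Y : Type*} [TopologicalSpace X] [TopologicalSpace Y]
    {f : X → Y} (hf : GeneralizingMap f) (hs : Function.Surjective f) (c : ℕ → Y)
    (hc : ∀ i, c (i + 1) ⤳ c i) : ∃ d : ℕ → X, (∀ i, f (d i) = c i) ∧ ∀ i, d (i + 1) ⤳ d i := by
  choose g hg hfg using fun (i : ℕ) (x : { x : X // f x = c i }) ↦
    hf (show c (i + 1) ⤳ f x.1 from x.2.symm ▸ hc i)
  let d : ∀ i, { x : X // f x = c i } := fun i ↦
    Nat.rec ⟨_, (hs (c 0)).choose_spec⟩ (fun i x ↦ ⟨g i x, hfg i x⟩) i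
  exact ⟨fun i ↦ (d i).1, fun i ↦ (d i).2, fun i ↦ hg i (d i)⟩

/-- In a fibre product over the spectrum of a field, chains in the first factor lift to the fibre
over any point of the second factor. -/
theorem AlgebraicGeometry.exists_chain_pullback {X Y : Scheme} {K : Type} [Field K]
    (p : X ⟶ Spec (.of K)) (q : Y ⟶ Spec (.of K)) (y : Y) (c : ℕ → X)
    (hc : ∀ i, c (i + 1) ⤳ c i) :
    ∃ d : ℕ → ↥(pullback p q), (∀ i, pullback.fst p q (d i) = c i) ∧
      (∀ i, pullback.snd p q (d i) = y) ∧ ∀ i, d (i + 1) ⤳ d i := by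
  let j := Y.fromSpecResidueField y
  let r : pullback p (j ≫ q) ⟶ pullback p q :=
    pullback.map _ _ _ _ (𝟙 X) j (𝟙 _) (by simp) (by simp)
  obtain ⟨d, hd, hd'⟩ := (Flat.generalizingMap (pullback.fst p (j ≫ q))).exists_lift_chain
    (pullback.fst p (j ≫ q)).surjective c hc
  refine ⟨fun i ↦ r (d i), fun i ↦ ?_, fun i ↦ ?_, fun i ↦ (hd' i).map r.continuous⟩
  · rw [← Scheme.Hom.comp_apply, pullback.lift_fst, Category.comp_id, hd]
  · rw [← Scheme.Hom.comp_apply, pullback.lift_snd, Scheme.Hom.comp_apply,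
      Scheme.fromSpecResidueField_apply]

end Chains

/-- If the fiber product `ℙⁿ_ℂ ×_{Spec ℂ} ℙ¹_ℂ` admits a closed immersion into `ℙᵐ_ℂ` over
`Spec ℂ`, then `m ≥ 2n + 1`. -/
theorem le_of_closedImmersion_pullback_proj (n m : ℕ) (hn : 1 ≤ n) (hm : 1 ≤ m)
    (p : ProjSpace n ⟶ Spec (CommRingCat.of ℂ))
    (q : ProjSpace 1 ⟶ Spec (CommRingCat.of ℂ))
    (sM : ProjSpace m ⟶ Spec (CommRingCat.of ℂ))
    (ι : pullback p q ⟶ ProjSpace m) (hι : IsClosedImmersion ι)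
    (hcomm : ι ≫ sM = pullback.fst p q ≫ p) :
    2 * n + 1 ≤ m := by
  have hspec {N : ℕ} (x y : ProjSpace N) : x ⤳ y ↔
      (show ProjectiveSpectrum (MvPolynomial.homogeneousSubmodule (Fin (N + 1)) ℂ) from x) ≤ y := by
    rw [specializes_iff_mem_closure]
    exact (ProjectiveSpectrum.le_iff_mem_closure _ x y).symm
  have hne (i : ℕ) : {j : Fin (n + 1) | (j : ℕ) < n - i} ≠ Set.univ := fun h ↦ by
    have : Fin.last n ∈ {j : Fin (n + 1) | (j : ℕ) < n - i} := h ▸ Set.mem_univ _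
    simp at this
    omega
  let c : ℕ → ProjSpace n := fun i ↦
    ProjectiveSpectrum.coordinate {j : Fin (n + 1) | (j : ℕ) < n - i} (hne i)
  have hc (i : ℕ) : c (i + 1) ⤳ c i := by
    rw [hspec]
    exact Ideal.span_mono (Set.image_mono fun j (hj : (j : ℕ) < n - (i + 1)) ↦
      show (j : ℕ) < n - i by omega)
  have hc' (i : ℕ) (hi : i < n) : c (i + 1) ≠ c i := fun h ↦ by
    have hle := (hspec (c i) (c (i + 1))).1 (h ▸ specializes_rfl)
    let j : Fin (n + 1) := ⟨n - (i + 1), by omega⟩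
    have hj : j ∈ {j : Fin (n + 1) | (j : ℕ) < n - (i + 1)} :=
      MvPolynomial.X_mem_span_X_image.1
        (hle (MvPolynomial.X_mem_span_X_image.2 (show n - (i + 1) < n - i by omega)))
    exact lt_irrefl (n - (i + 1)) (show (j : ℕ) < n - (i + 1) from hj)
  have hpt (j : Fin 2) : ({j} : Set (Fin 2)) ≠ Set.univ := by
    fin_cases j <;> simp [Set.ext_iff, Fin.forall_fin_two]
  let pt : Fin 2 → ProjSpace 1 := fun j ↦ ProjectiveSpectrum.coordinate {j} (hpt j)
  have hdisj (z : ProjSpace 1) (h₀ : pt 0 ⤳ z) (h₁ : pt 1 ⤳ z) : False := by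
    rw [hspec] at h₀ h₁
    refine (ProjectiveSpectrum.asHomogeneousIdeal_lt_ker_aeval_zero z).not_ge
      fun f hf ↦ ?_
    have hX : Ideal.span (MvPolynomial.X '' (Set.univ : Set (Fin 2))) ≤
        z.asHomogeneousIdeal.toIdeal := by
      rw [Ideal.span_le]
      rintro _ ⟨j, -, rfl⟩
      fin_cases j
      · exact h₀ (MvPolynomial.X_mem_span_X_image.2 rfl)
      · exact h₁ (MvPolynomial.X_mem_span_X_image.2 rfl)
    refine hX (MvPolynomial.mem_ideal_span_X_image.2 fun s hs ↦ ?_)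
    by_contra! h
    obtain rfl : s = 0 := Finsupp.ext fun j ↦ h j trivial
    refine MvPolynomial.mem_support_iff.1 hs ?_
    simpa [MvPolynomial.constantCoeff_eq] using hf
  choose d hdc hdp hd using fun j ↦ exists_chain_pullback p q (pt j) c hc
  have hemb := ι.isClosedEmbedding
  have := ProjectiveSpectrum.add_lt_of_chains (N := m) (k := ℂ) (fun i ↦ ι (d 0 i))
    (fun i ↦ ι (d 1 i)) (antitone_nat_of_succ_le fun i ↦ (hspec _ _).1 ((hd 0 i).map ι.continuous))
    (antitone_nat_of_succ_le fun i ↦ (hspec _ _).1 ((hd 1 i).map ι.continuous)) n n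
    (fun i hi h ↦ hc' i hi (by rw [← hdc 0, ← hdc 0, hemb.injective h]))
    (fun i hi h ↦ hc' i hi (by rw [← hdc 1, ← hdc 1, hemb.injective h]))
    fun z h₀ h₁ ↦ by
      replace h₀ := (hspec (N := m) _ _).2 h₀
      replace h₁ := (hspec (N := m) _ _).2 h₁
      obtain ⟨u, rfl⟩ := h₀.mem_closed hemb.isClosed_range ⟨_, rfl⟩
      rw [hemb.isInducing.specializes_iff] at h₀ h₁
      refine hdisj (pullback.snd p q u) ?_ ?_
      · exact hdp 0 n ▸ h₀.map (pullback.snd p q).continuous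
      · exact hdp 1 n ▸ h₁.map (pullback.snd p q).continuous
  omega
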